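/- For every normalized finite Rademacher sum X = Σ_{i=1}^n a_i ε_i, one has P(|X| ≥ 1/√5) ≥ 29/64. -/

import Mathlib

/-- The probability that a finite Rademacher sum with weights `a` (signs chosen
independently and uniformly from `{-1,+1}`) satisfies the predicate `p`. -/
noncomputable def radProb {ι : Type*} [Fintype ι] (a : ι → ℝ) (p : ℝ → Prop) : ℝ :=
  (Nat.card {ε : ι → Bool | p (∑ i, a i * (if ε i then (1 : ℝ) else -1))}) /
    2 ^ (Fintype.card ι)

open Real

/-- Twice the probability that the absolute value of `s` plus the Rademacher sum with weights `l`
is less than `2`, minus one. -/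
noncomputable def signExcess : List ℝ → ℝ → ℝ
  | [], s => if |s| < 2 then 1 else -1
  | a :: l, s => (signExcess l (s + a) + signExcess l (s - a)) / 2

theorem signExcess_neg (l : List ℝ) (s : ℝ) : signExcess l (-s) = signExcess l s := by
  induction l generalizing s with
  | nil => simp [signExcess]
  | cons a l ih =>
    have h1 : -s + a = -(s - a) := by ring
    have h2 : -s - a = -(s + a) := by ring
    simp only [signExcess, h1, h2, ih]
    ring

theorem signExcess_abs (l : List ℝ) (s : ℝ) : signExcess l |s| = signExcess l s := by
  rcases abs_choice s with h | h <;> rw [h]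
  exact signExcess_neg l s

theorem signExcess_add_nonpos (l : List ℝ) {s t : ℝ} (h : 4 ≤ |s - t|) :
    signExcess l s + signExcess l t ≤ 0 := by
  induction l generalizing s t with
  | nil =>
    simp only [signExcess]
    by_cases hs : |s| < 2 <;> by_cases ht : |t| < 2 <;> simp [hs, ht]
    have := abs_sub s t
    linarith
  | cons a l ih =>
    have h1 := ih (s := s + a) (t := t + a) (by simpa using h)
    have h2 := ih (s := s - a) (t := t - a) (by simpa using h)
    simp only [signExcess]
    linarith

theorem signExcess_nonpos (l : List ℝ) {s : ℝ} (h : 2 ≤ |s|) : signExcess l s ≤ 0 := by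
  have := signExcess_add_nonpos l (s := s) (t := -s) (by
    rw [sub_neg_eq_add, ← two_mul, abs_mul, abs_two]; linarith)
  rw [signExcess_neg] at this
  linarith

theorem signExcess_perm {l l' : List ℝ} (h : l.Perm l') (s : ℝ) :
    signExcess l s = signExcess l' s := by
  induction h generalizing s with
  | nil => rfl
  | cons a _ ih => simp only [signExcess, ih]
  | swap a b l =>
    have h1 : s + b - a = s - a + b := by ring
    have h2 : s - b + a = s + a - b := by ring
    have h3 : s + b + a = s + a + b := by ring
    have h4 : s - b - a = s - a - b := by ring
    simp only [signExcess, h1, h2, h3, h4]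
    ring
  | trans _ _ ih1 ih2 => rw [ih1, ih2]

theorem signExcess_append_le {l L : List ℝ} {c : ℝ} (h : ∀ x, signExcess L x ≤ c) (x : ℝ) :
    signExcess (l ++ L) x ≤ c := by
  induction l generalizing x with
  | nil => exact h x
  | cons a l ih =>
    have h1 := ih (x + a)
    have h2 := ih (x - a)
    simp only [List.cons_append, signExcess]
    linarith

theorem signExcess_map_abs (l : List ℝ) (s : ℝ) :
    signExcess (l.map abs) s = signExcess l s := by
  induction l generalizing s with
  | nil => rfl
  | cons a l ih =>
    simp only [List.map_cons, signExcess, ih]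
    rcases abs_choice a with h | h <;> rw [h]
    rw [sub_neg_eq_add, ← sub_eq_add_neg, add_comm]

theorem signExcess_ofFn {n : ℕ} (a : Fin n → ℝ) (s : ℝ) :
    signExcess (List.ofFn a) s =
      (∑ ε : Fin n → Bool,
        if |s + ∑ i, a i * (if ε i then (1 : ℝ) else -1)| < 2 then (1 : ℝ) else -1) / 2 ^ n := by
  induction n generalizing s with
  | zero => simp [signExcess]
  | succ n ih =>
    rw [List.ofFn_succ, signExcess, ih, ih,
      ← (Fin.consEquiv (fun _ : Fin (n + 1) => Bool)).sum_comp, Fintype.sum_prod_type,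
      Fintype.sum_bool]
    simp only [Fin.consEquiv_apply, Fin.sum_univ_succ, Fin.cons_zero, Fin.cons_succ, ite_true,
      Bool.false_eq_true, ite_false, mul_one, mul_neg, ← add_assoc, ← sub_eq_add_neg, pow_succ]
    field_simp

/-- Total mass that a decreasing chain of `j` points with gaps at least `2` can carry, with `k`
summands of size at least `1`. -/
noncomputable def chainBound : ℕ → ℕ → ℝ
  | 0, j => 2 * min (2 : ℝ) j
  | _ + 1, 0 => 0
  | k + 1, j + 1 => (chainBound k (j + 2) + chainBound k j) / 2

theorem sum_chain_le_four {xs : List ℝ} (h : xs.Pairwise fun x y => y + 2 ≤ x) :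
    (xs.map fun x => signExcess [] x + 1).sum ≤ 4 := by
  have far : ∀ xs : List ℝ, (∀ x ∈ xs, x ≤ -2) →
      (xs.map fun x => signExcess [] x + 1).sum ≤ 0 := by
    intro xs hxs
    induction xs with
    | nil => simp
    | cons x xs ih =>
      have h1 := ih fun y hy => hxs y (by simp [hy])
      have h2 : ¬ |x| < 2 := by
        have := hxs x (by simp)
        rw [abs_lt]; intro h; linarith
      simpa [signExcess, h2] using h1
  have half : ∀ xs : List ℝ, (xs.Pairwise fun x y => y + 2 ≤ x) → (∀ x ∈ xs, x ≤ 0) →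
      (xs.map fun x => signExcess [] x + 1).sum ≤ 2 := by
    intro xs hp hxs
    cases xs with
    | nil => simp
    | cons x xs =>
      rw [List.pairwise_cons] at hp
      have hx := hxs x (by simp)
      have := far xs fun y hy => by linarith [hp.1 y hy]
      have h1 : signExcess [] x ≤ 1 := by simp only [signExcess]; split_ifs <;> norm_num
      simp only [List.map_cons, List.sum_cons]
      linarith
  induction xs with
  | nil => simp
  | cons x xs ih =>
    rw [List.pairwise_cons] at h
    simp only [List.map_cons, List.sum_cons]
    by_cases hx : 2 ≤ x
    · have h2 : ¬ |x| < 2 := by rw [abs_lt]; intro h; linarith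
      have := ih h.2
      simp only [signExcess, h2, if_false] at this ⊢
      linarith
    · have := half xs h.2 fun y hy => by linarith [h.1 y hy]
      have h1 : signExcess [] x ≤ 1 := by simp only [signExcess]; split_ifs <;> norm_num
      linarith

theorem sum_chain_le {l : List ℝ} (hl : ∀ b ∈ l, 1 ≤ b) {xs : List ℝ}
    (h : xs.Pairwise fun x y => y + 2 ≤ x) :
    (xs.map fun x => signExcess l x + 1).sum ≤ chainBound l.length xs.length := by
  induction l generalizing xs with
  | nil =>
    simp only [List.length_nil, chainBound]
    have h1 := sum_chain_le_four h
    have h2 : (xs.map fun x => signExcess [] x + 1).sum ≤ xs.length * 2 := by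
      have := List.sum_le_card_nsmul (xs.map fun x => signExcess [] x + 1) 2 (by
        intro y hy
        obtain ⟨x, -, rfl⟩ := List.mem_map.1 hy
        simp only [signExcess]; split_ifs <;> norm_num)
      simpa using this
    rcases min_choice (2 : ℝ) xs.length with h3 | h3 <;> rw [h3] <;> linarith
  | cons b l ih =>
    have hb : 1 ≤ b := hl b (by simp)
    have hl' : ∀ c ∈ l, 1 ≤ c := fun c hc => hl c (by simp [hc])
    cases xs with
    | nil => simp [chainBound]
    | cons z ys =>
      rw [List.pairwise_cons] at h
      have hup := ih hl' (xs := ys.map (· + b)) (by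
        rw [List.pairwise_map]
        exact h.2.imp fun h => by linarith)
      have hdown := ih hl' (xs := (z + b) :: (z - b) :: ys.map (· - b)) (by
        simp only [List.pairwise_cons, List.pairwise_map, List.mem_cons, List.mem_map]
        refine ⟨?_, ?_, h.2.imp fun h => by linarith⟩
        · rintro _ (rfl | ⟨y, hy, rfl⟩)
          · linarith
          · linarith [h.1 y hy]
        · rintro _ ⟨y, hy, rfl⟩
          linarith [h.1 y hy])
      have key : ∀ ys : List ℝ, (ys.map fun x => signExcess (b :: l) x + 1).sum =
          ((ys.map fun x => signExcess l (x + b) + 1).sum +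
            (ys.map fun x => signExcess l (x - b) + 1).sum) / 2 := by
        intro ys
        induction ys with
        | nil => simp
        | cons y ys ihy =>
          simp only [List.map_cons, List.sum_cons, ihy]
          simp only [signExcess]
          ring
      rw [key]
      simp only [List.map_cons, List.sum_cons, List.length_cons, List.length_map, List.map_map,
        Function.comp_def, chainBound] at hup hdown ⊢
      linarith

theorem signExcess_le_chainBound {l : List ℝ} (hl : ∀ b ∈ l, 1 ≤ b) (x : ℝ) :
    signExcess l x ≤ chainBound l.length 1 - 1 := by
  have := sum_chain_le hl (xs := [x]) (by simp)
  simp only [List.map_cons, List.map_nil, List.sum_cons, List.sum_nil, List.length_cons,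
    List.length_nil] at this
  linarith

theorem cos_le_exp_neg_sq_div_two {x : ℝ} (h0 : 0 ≤ x) (h1 : x ≤ π / 2) :
    cos x ≤ exp (-(x ^ 2 / 2)) := by
  have anti : AntitoneOn (fun x : ℝ => cos x * exp (x ^ 2 / 2)) (Set.Icc 0 (π / 2)) := by
    apply antitoneOn_of_deriv_nonpos (convex_Icc _ _) (by fun_prop) (by fun_prop)
    intro y hy
    rw [interior_Icc] at hy
    have hd : HasDerivAt (fun x : ℝ => cos x * exp (x ^ 2 / 2))
        (-sin y * exp (y ^ 2 / 2) + cos y * (exp (y ^ 2 / 2) * y)) y := by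
      have h2 : HasDerivAt (fun x : ℝ => x ^ 2 / 2) y y := by
        simpa using (hasDerivAt_pow 2 y).div_const 2
      exact (hasDerivAt_cos y).mul h2.exp
    rw [hd.deriv]
    have hc : 0 < cos y := cos_pos_of_mem_Ioo ⟨by linarith [hy.1, pi_pos], hy.2⟩
    have ht := le_tan hy.1.le hy.2
    rw [tan_eq_sin_div_cos, le_div_iff₀ hc] at ht
    nlinarith [exp_pos (y ^ 2 / 2)]
  have := anti ⟨le_refl 0, by positivity⟩ ⟨h0, h1⟩ h0
  simp only [cos_zero, ne_eq, OfNat.ofNat_ne_zero, not_false_eq_true, zero_pow, zero_div,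
    exp_zero, mul_one] at this
  rw [exp_neg, ← one_div, le_div_iff₀ (exp_pos _)]
  exact this

theorem cos_mul_le_exp {θ κ r : ℝ} (hθ : 0 ≤ θ) (hκ : κ ≤ θ ^ 2 / 2) (h0 : 0 ≤ r)
    (h1 : θ * r ≤ π / 2) : cos (θ * r) ≤ exp (-(κ * r ^ 2)) := by
  refine (cos_le_exp_neg_sq_div_two (by positivity) h1).trans (exp_le_exp.2 ?_)
  nlinarith [mul_le_mul_of_nonneg_right hκ (sq_nonneg r)]

theorem pi_div_six_sq : (0.137 : ℝ) ≤ (π / 6) ^ 2 / 2 := by nlinarith [pi_gt_d4]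

theorem pi_div_two_sq : (1.233 : ℝ) ≤ (π / 2) ^ 2 / 2 := by nlinarith [pi_gt_d4]

theorem pi_div_four_sq : (0.3084 : ℝ) ≤ (π / 4) ^ 2 / 2 := by nlinarith [pi_gt_d4]

/-- The sum of the squares of the entries. -/
noncomputable def sumSq (R : List ℝ) : ℝ := (R.map (· ^ 2)).sum

/-- The characteristic function of the Rademacher sum with weights `R`, at frequency `θ`. -/
noncomputable def cosProd (R : List ℝ) (θ : ℝ) : ℝ := (R.map fun r => cos (θ * r)).prod

@[simp] theorem sumSq_nil : sumSq [] = 0 := rfl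
@[simp] theorem sumSq_cons (r : ℝ) (R : List ℝ) : sumSq (r :: R) = r ^ 2 + sumSq R := rfl
@[simp] theorem cosProd_nil (θ : ℝ) : cosProd [] θ = 1 := rfl
@[simp] theorem cosProd_cons (r : ℝ) (R : List ℝ) (θ : ℝ) :
    cosProd (r :: R) θ = cos (θ * r) * cosProd R θ := rfl

theorem sumSq_append (l l' : List ℝ) : sumSq (l ++ l') = sumSq l + sumSq l' := by
  simp [sumSq]

theorem sumSq_nonneg (l : List ℝ) : 0 ≤ sumSq l := by
  induction l with
  | nil => simp
  | cons r R ih => rw [sumSq_cons]; positivity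

theorem sumSq_perm {l l' : List ℝ} (h : l.Perm l') : sumSq l = sumSq l' :=
  (h.map _).sum_eq

/-- All summands lie in `[0, 1]`. -/
def IsSmall (R : List ℝ) : Prop := ∀ r ∈ R, 0 ≤ r ∧ r ≤ 1

theorem IsSmall.tail {r : ℝ} {R : List ℝ} (h : IsSmall (r :: R)) : IsSmall R :=
  fun x hx => h x (by simp [hx])

theorem IsSmall.head {r : ℝ} {R : List ℝ} (h : IsSmall (r :: R)) : 0 ≤ r ∧ r ≤ 1 :=
  h r (by simp)

theorem cosProd_nonneg {R : List ℝ} (hR : IsSmall R) {θ : ℝ} (h0 : 0 ≤ θ) (h1 : θ ≤ π / 2) :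
    0 ≤ cosProd R θ := by
  induction R with
  | nil => simp
  | cons r R ih =>
    have := hR.head
    rw [cosProd_cons]
    refine mul_nonneg (cos_nonneg_of_neg_pi_div_two_le_of_le ?_ ?_) (ih hR.tail)
    · nlinarith [pi_pos]
    · nlinarith [pi_pos]

theorem cosProd_le_exp {R : List ℝ} (hR : IsSmall R) {θ κ : ℝ} (h0 : 0 ≤ θ) (h1 : θ ≤ π / 2)
    (hκ : κ ≤ θ ^ 2 / 2) : cosProd R θ ≤ exp (-(κ * sumSq R)) := by
  induction R with
  | nil => simp
  | cons r R ih =>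
    have := hR.head
    rw [cosProd_cons, sumSq_cons, mul_add, neg_add, exp_add]
    refine mul_le_mul (cos_mul_le_exp h0 hκ this.1 ?_) (ih hR.tail)
      (cosProd_nonneg hR.tail h0 h1) (exp_pos _).le
    nlinarith [pi_pos]

theorem cosProd_anti {R : List ℝ} (hR : IsSmall R) {θ φ : ℝ} (h0 : 0 ≤ θ) (hθ : θ ≤ φ)
    (h1 : φ ≤ π / 2) : cosProd R φ ≤ cosProd R θ := by
  induction R with
  | nil => simp
  | cons r R ih =>
    have := hR.head
    rw [cosProd_cons, cosProd_cons]
    refine mul_le_mul ?_ (ih hR.tail) (cosProd_nonneg hR.tail (h0.trans hθ) h1) ?_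
    · apply cos_le_cos_of_nonneg_of_le_pi
      · nlinarith
      · nlinarith [pi_pos]
      · nlinarith
    · apply cos_nonneg_of_neg_pi_div_two_le_of_le <;> nlinarith [pi_pos]

theorem cos_pi_div_two_mul (s : ℝ) :
    cos (π / 2 * s) = 4 * cos (π / 6 * s) ^ 3 - 3 * cos (π / 6 * s) := by
  rw [← cos_three_mul]
  congr 1
  ring

/-- A two-frequency majorant of `signExcess R`. -/
noncomputable def cosBound (R : List ℝ) (s : ℝ) : ℝ :=
  4 / 3 * cosProd R (π / 6) * cos (π / 6 * s) - 1 / 3 * cosProd R (π / 2) * cos (π / 2 * s)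

theorem cosBound_abs (R : List ℝ) (s : ℝ) : cosBound R |s| = cosBound R s := by
  rcases abs_choice s with h | h <;> rw [h]
  simp only [cosBound, mul_neg, cos_neg]

theorem cosBound_cons (r : ℝ) (R : List ℝ) (s : ℝ) :
    cosBound (r :: R) s = (cosBound R (s + r) + cosBound R (s - r)) / 2 := by
  simp only [cosBound, cosProd_cons, mul_add, mul_sub, cos_add, cos_sub]
  ring

theorem cosBound_nonneg {R : List ℝ} (hR : IsSmall R) {s : ℝ} (h1 : 1 ≤ |s|) (h3 : |s| ≤ 3) :
    0 ≤ cosBound R s := by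
  rw [← cosBound_abs, cosBound]
  have hc : 0 ≤ cos (π / 6 * |s|) := by
    apply cos_nonneg_of_neg_pi_div_two_le_of_le <;> nlinarith [pi_pos, abs_nonneg s]
  have hd : cos (π / 2 * |s|) ≤ 0 := by
    apply cos_nonpos_of_pi_div_two_le_of_le <;> nlinarith [pi_pos, abs_nonneg s]
  have hC := cosProd_nonneg hR (θ := π / 6) (by positivity) (by linarith [pi_pos])
  have hD := cosProd_nonneg hR (θ := π / 2) (by positivity) le_rfl
  have := mul_nonneg hC hc
  have := mul_nonneg hD (neg_nonneg.2 hd)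
  linarith

theorem signExcess_le_cosBound {R : List ℝ} (hR : IsSmall R) {s : ℝ} (hs : |s| ≤ 3) :
    signExcess R s ≤ cosBound R s := by
  induction R generalizing s with
  | nil =>
    by_cases h2 : |s| < 2
    · rw [← cosBound_abs]
      simp only [signExcess, h2, if_true, cosBound, cosProd_nil, cos_pi_div_two_mul]
      have h3 : 1 / 2 ≤ cos (π / 6 * |s|) := by
        rw [← cos_pi_div_three]
        apply cos_le_cos_of_nonneg_of_le_pi <;> nlinarith [pi_pos, abs_nonneg s]
      have h4 := cos_le_one (π / 6 * |s|)
      set c := cos (π / 6 * |s|)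
      nlinarith [mul_nonneg (mul_nonneg (sub_nonneg.2 h3) (sub_nonneg.2 h4))
        (by linarith : 0 ≤ c + 3 / 2)]
    · exact (signExcess_nonpos _ (not_lt.1 h2)).trans
        (cosBound_nonneg hR (by linarith) hs)
  | cons r R ih =>
    by_cases h2 : |s| < 2
    · rw [cosBound_cons, signExcess]
      have hr := hR.head
      have h2' := abs_lt.1 h2
      have h3 := ih hR.tail (s := s + r) (abs_le.2 ⟨by linarith, by linarith⟩)
      have h4 := ih hR.tail (s := s - r) (abs_le.2 ⟨by linarith, by linarith⟩)
      linarith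
    · exact (signExcess_nonpos _ (not_lt.1 h2)).trans
        (cosBound_nonneg hR (by linarith) hs)

theorem cosBound_le {R : List ℝ} (hR : IsSmall R) {s : ℝ} (hs : |s| ≤ 3) :
    cosBound R s ≤ 4 / 3 * cosProd R (π / 6) := by
  rw [← cosBound_abs, cosBound, cos_pi_div_two_mul]
  have hc : 0 ≤ cos (π / 6 * |s|) := by
    apply cos_nonneg_of_neg_pi_div_two_le_of_le <;> nlinarith [pi_pos, abs_nonneg s]
  have hc1 := cos_le_one (π / 6 * |s|)
  have hD := cosProd_nonneg hR (θ := π / 2) (by positivity) le_rfl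
  have hDC := cosProd_anti hR (θ := π / 6) (φ := π / 2) (by positivity) (by linarith [pi_pos])
    le_rfl
  set c := cos (π / 6 * |s|)
  set C := cosProd R (π / 6)
  set D := cosProd R (π / 2)
  have hC : 0 ≤ C := hD.trans hDC
  by_cases h : 0 ≤ 4 * c ^ 3 - 3 * c
  · nlinarith [mul_nonneg hD h, mul_nonneg hC (sub_nonneg.2 hc1)]
  · have h1 : -(1 / 3 * D * (4 * c ^ 3 - 3 * c)) ≤ -(1 / 3 * C * (4 * c ^ 3 - 3 * c)) := by
      nlinarith
    have h2 : 7 * c - 4 * c ^ 3 ≤ 4 := by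
      nlinarith [sq_nonneg (c - 3 / 4), mul_nonneg hc (sq_nonneg (c - 3 / 4))]
    nlinarith [mul_le_mul_of_nonneg_left h2 hC]

theorem signExcess_le_four_thirds_exp {R : List ℝ} (hR : IsSmall R) (s : ℝ) :
    signExcess R s ≤ 4 / 3 * exp (-(0.137 * sumSq R)) := by
  by_cases h2 : |s| < 2
  · have h1 := cosProd_le_exp hR (θ := π / 6) (by positivity) (by linarith [pi_pos]) pi_div_six_sq
    have := signExcess_le_cosBound hR (s := s) (by linarith)
    have := cosBound_le hR (s := s) (by linarith)
    linarith
  · exact (signExcess_nonpos _ (not_lt.1 h2)).trans (by positivity)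

theorem signExcess_cons_zero (b : ℝ) (L : List ℝ) : signExcess (b :: L) 0 = signExcess L b := by
  rw [signExcess, zero_add, zero_sub, signExcess_neg]
  ring

theorem signExcess_cons_le_half {b u : ℝ} (L : List ℝ) (h : 2 ≤ u + b) :
    signExcess (b :: L) u ≤ signExcess L (b - u) / 2 := by
  have h1 := signExcess_nonpos L (s := u + b) (h.trans (le_abs_self _))
  rw [signExcess, ← signExcess_neg L (u - b), neg_sub]
  linarith

theorem signExcess_pair_le {b₁ b₂ s : ℝ} (L : List ℝ) (h : 2 + |s| ≤ b₁ + b₂) :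
    signExcess (b₁ :: b₂ :: L) s ≤ signExcess ((b₂ - b₁) :: L) s / 2 := by
  have h1 := signExcess_nonpos L (s := s + b₁ + b₂)
    (by linarith [le_abs_self (s + b₁ + b₂), neg_abs_le s])
  have h2 := signExcess_nonpos L (s := s - b₁ - b₂)
    (by linarith [neg_le_abs (s - b₁ - b₂), le_abs_self s])
  have h3 : s + (b₂ - b₁) = s - b₁ + b₂ := by ring
  have h4 : s - (b₂ - b₁) = s + b₁ - b₂ := by ring
  simp only [signExcess, h3, h4]
  linarith

theorem signExcess_alternate {L : List ℝ} {c : ℝ} (hL : ∀ x, signExcess L x ≤ c)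
    {b : ℝ} {bs : List ℝ} {u β : ℝ} (hs : (b :: bs).Pairwise (· ≤ ·))
    (hβ : ∀ x ∈ bs, 2 - x ≤ β) (hu : 2 - b ≤ u) (hu' : u + (2 - b) + β ≤ 2) :
    signExcess (b :: bs ++ L) u ≤ c / 2 ^ (bs.length + 1) := by
  induction bs generalizing b u β with
  | nil =>
    refine (signExcess_cons_le_half L (by linarith)).trans ?_
    have := hL (b - u)
    simp only [List.length_nil, zero_add, pow_one]
    linarith
  | cons b' bs ih =>
    rw [List.pairwise_cons] at hs
    have hb : b ≤ b' := hs.1 b' (by simp)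
    have hb' : 2 - b' ≤ β := hβ b' (by simp)
    have h1 := signExcess_cons_le_half (u := u) (b := b) (b' :: bs ++ L) (by linarith)
    have h2 := ih (u := b - u) (β := u) hs.2
      (fun x hx => by linarith [hs.1 x (by simp [hx])]) (by linarith) (by linarith)
    rw [List.length_cons, pow_succ, ← div_div]
    exact h1.trans (by linarith)

/-- Summands of size less than `δ` cannot jump over `δ ≤ |s| < 2 δ`: bound `signExcess (R ++ T)`
from a bound `c` valid once that region is reached and a bound `W` valid if it never is. -/
theorem signExcess_walk {T : List ℝ} {δ c W q : ℝ} (hδ : 0 < δ) (hδ1 : δ ≤ 1)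
    (hq0 : 0 < q) (hq : q ≤ cos (π / 6 * (2 * δ))) (hc : 0 ≤ c) (hW0 : 0 ≤ W)
    (hW : ∀ x, signExcess T x ≤ W)
    {R : List ℝ} (hR : ∀ r ∈ R, 0 ≤ r ∧ r < δ)
    (hfinish : ∀ R', IsSmall R' → ∀ x, δ ≤ |x| → |x| ≤ max 1 (2 * δ) →
      signExcess (R' ++ T) x ≤ c * exp (-(0.137 * sumSq R')))
    {s : ℝ} (hs : |s| < 2 * δ) :
    signExcess (R ++ T) s ≤ c / q * cos (π / 6 * s) * exp (-(0.137 * sumSq R)) +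
      √2 * W * cos (π / 4 / δ * s) * exp (-(0.3084 / δ ^ 2 * sumSq R)) := by
  have hcosγ : ∀ s : ℝ, |s| < 2 * δ → q ≤ cos (π / 6 * s) := by
    intro s hs
    refine hq.trans ?_
    rw [← cos_abs (π / 6 * s), abs_mul, abs_of_pos (by positivity : 0 < π / 6)]
    apply cos_le_cos_of_nonneg_of_le_pi
    · positivity
    · nlinarith [pi_pos]
    · nlinarith [pi_pos]
  have hlam : ∀ s : ℝ, |π / 4 / δ * s| = π / 4 * (|s| / δ) := by
    intro s
    rw [abs_mul, abs_of_pos (by positivity : 0 < π / 4 / δ)]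
    ring
  have hcosl : ∀ s : ℝ, |s| < 2 * δ → 0 ≤ cos (π / 4 / δ * s) := by
    intro s hs
    have h1 : |s| / δ < 2 := by rwa [div_lt_iff₀ hδ]
    rw [← cos_abs, hlam]
    have : 0 ≤ |s| / δ := by positivity
    apply cos_nonneg_of_neg_pi_div_two_le_of_le <;> nlinarith [pi_pos]
  have hfar : ∀ R, IsSmall R → ∀ s, δ ≤ |s| → |s| < 2 * δ →
      signExcess (R ++ T) s ≤ c / q * cos (π / 6 * s) * exp (-(0.137 * sumSq R)) +
      √2 * W * cos (π / 4 / δ * s) * exp (-(0.3084 / δ ^ 2 * sumSq R)) := by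
    intro R hR s h1 h2
    have h3 := hfinish R hR s h1 (h2.le.trans (le_max_right _ _))
    have h4 : c ≤ c / q * cos (π / 6 * s) := by
      rw [div_mul_eq_mul_div, le_div_iff₀ hq0]
      exact mul_le_mul_of_nonneg_left (hcosγ s h2) hc
    have h5 := mul_le_mul_of_nonneg_right h4 (exp_pos (-(0.137 * sumSq R))).le
    have h6 : 0 ≤ √2 * W * cos (π / 4 / δ * s) * exp (-(0.3084 / δ ^ 2 * sumSq R)) :=
      mul_nonneg (mul_nonneg (by positivity) (hcosl s h2)) (exp_pos _).le
    linarith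
  induction R generalizing s with
  | nil =>
    by_cases h : δ ≤ |s|
    · exact hfar [] (by simp [IsSmall]) s h hs
    · rw [not_le] at h
      have h1 : |s| / δ < 1 := by rwa [div_lt_one hδ]
      have h2 : √2 / 2 ≤ cos (π / 4 / δ * s) := by
        rw [← cos_pi_div_four, ← cos_abs (π / 4 / δ * s), hlam]
        have : 0 ≤ |s| / δ := by positivity
        apply cos_le_cos_of_nonneg_of_le_pi <;> nlinarith [pi_pos]
      have h3 := hcosγ s hs
      have h4 : 0 ≤ c / q * cos (π / 6 * s) := mul_nonneg (by positivity) (hq0.le.trans h3)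
      have h5 := mul_le_mul_of_nonneg_left h2 (by positivity : 0 ≤ √2 * W)
      have h6 : √2 * W * (√2 / 2) = W := by
        have := mul_self_sqrt (show (0 : ℝ) ≤ 2 by norm_num)
        linear_combination W / 2 * this
      have := hW s
      simp only [List.nil_append, sumSq_nil, mul_zero, neg_zero, exp_zero, mul_one]
      linarith
  | cons r R ih =>
    have hr := hR r (by simp)
    have hR' : ∀ x ∈ R, 0 ≤ x ∧ x < δ := fun x hx => hR x (by simp [hx])
    have hsm : IsSmall (r :: R) := fun x hx => ⟨(hR x hx).1, ((hR x hx).2.trans_le hδ1).le⟩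
    by_cases h : δ ≤ |s|
    · exact hfar _ hsm s h hs
    · rw [not_le] at h
      have hb := abs_lt.1 h
      have h1 := ih hR' (s := s + r) (abs_lt.2 ⟨by linarith, by linarith⟩)
      have h2 := ih hR' (s := s - r) (abs_lt.2 ⟨by linarith, by linarith⟩)
      have hγ : cos (π / 6 * r) ≤ exp (-(0.137 * r ^ 2)) :=
        cos_mul_le_exp (by positivity) pi_div_six_sq hr.1 (by nlinarith [pi_pos])
      have hl : cos (π / 4 / δ * r) ≤ exp (-(0.3084 / δ ^ 2 * r ^ 2)) := by
        apply cos_mul_le_exp (by positivity) _ hr.1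
        · rw [div_mul_eq_mul_div, div_le_div_iff₀ hδ two_pos]
          nlinarith [pi_pos]
        · rw [div_pow, div_right_comm]
          exact div_le_div_of_nonneg_right pi_div_four_sq (by positivity)
      set E := exp (-(0.137 * sumSq R))
      set F := exp (-(0.3084 / δ ^ 2 * sumSq R))
      have h3 : 0 ≤ c / q * cos (π / 6 * s) * E :=
        mul_nonneg (mul_nonneg (by positivity) (hq0.le.trans (hcosγ s hs))) (exp_pos _).le
      have h4 : 0 ≤ √2 * W * cos (π / 4 / δ * s) * F :=
        mul_nonneg (mul_nonneg (by positivity) (hcosl s hs)) (exp_pos _).le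
      have h5 := mul_le_mul_of_nonneg_left hγ h3
      have h6 := mul_le_mul_of_nonneg_left hl h4
      simp only [List.cons_append, signExcess, sumSq_cons, mul_add, neg_add, exp_add]
      simp only [mul_add, mul_sub, cos_add, cos_sub] at h1 h2
      calc _ ≤ c / q * cos (π / 6 * s) * E * cos (π / 6 * r) +
              √2 * W * cos (π / 4 / δ * s) * F * cos (π / 4 / δ * r) := by linarith
        _ ≤ _ := add_le_add h5 h6
        _ = _ := by ring

theorem signExcess_le_of_alternate {b β W q V t K : ℝ} {bs Ls R : List ℝ}
    (hs : (b :: bs).Pairwise (· ≤ ·)) (hb1 : 1 ≤ b) (hb2 : b < 2)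
    (hβ : ∀ x ∈ bs, 2 - x ≤ β) (hβ1 : 2 - b + β ≤ 1) (hβ3 : 3 * (2 - b) + β ≤ 2)
    (hq0 : 0 < q) (hq : q ≤ 1 - 0.1371 * (2 * (2 - b)) ^ 2) (hW0 : 0 ≤ W)
    (hW : ∀ x, signExcess (b :: bs ++ Ls) x ≤ W) (hR : IsSmall R)
    (hV : V ≤ sumSq R) (ht : (2 - b) ^ 2 * t ≤ sumSq R)
    (h1 : 4 / 3 / 2 ^ (bs.length + 1) * exp (-(0.137 * (V - 1))) ≤ K)
    (h2 : 4 / 3 / 2 ^ (bs.length + 1) / q * exp (-(0.137 * V)) +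
      1.4143 * W * exp (-(0.3084 * t)) ≤ K) :
    signExcess (R ++ (b :: bs ++ Ls)) 0 ≤ K := by
  have hδ : 0 < 2 - b := by linarith
  have hfinish : ∀ R', IsSmall R' → ∀ x, 2 - b ≤ |x| → |x| ≤ max 1 (2 * (2 - b)) →
      signExcess (R' ++ (b :: bs ++ Ls)) x ≤
        4 / 3 / 2 ^ (bs.length + 1) * exp (-(0.137 * sumSq R')) := by
    intro R' hR' x hx1 hx2
    have hL : ∀ y, signExcess (Ls ++ R') y ≤ 4 / 3 * exp (-(0.137 * sumSq R')) :=
      signExcess_append_le (signExcess_le_four_thirds_exp hR')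
    have hu : |x| + (2 - b) + β ≤ 2 := by
      rcases max_choice 1 (2 * (2 - b)) with h | h <;> rw [h] at hx2 <;> linarith
    have := signExcess_alternate hL hs hβ hx1 hu
    rw [signExcess_abs] at this
    have hp : (R' ++ (b :: bs ++ Ls)).Perm (b :: bs ++ (Ls ++ R')) := by
      rw [← List.append_assoc (b :: bs)]
      exact List.perm_append_comm
    rw [signExcess_perm hp]
    refine this.trans (le_of_eq ?_)
    ring
  by_cases hex : ∃ r ∈ R, 2 - b ≤ r
  · obtain ⟨r, hr, hrb⟩ := hex
    have hp := List.perm_cons_erase hr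
    rw [signExcess_perm (hp.append_right _), List.cons_append, signExcess_cons_zero]
    have hR' : IsSmall (r :: R.erase r) := fun x hx => hR x (hp.mem_iff.2 hx)
    have hr' := hR'.head
    have habs : |r| = r := abs_of_nonneg hr'.1
    refine (hfinish _ hR'.tail r (by rw [habs]; exact hrb)
      (by rw [habs]; exact hr'.2.trans (le_max_left _ _))).trans (le_trans ?_ h1)
    refine mul_le_mul_of_nonneg_left (exp_le_exp.2 ?_) (by positivity)
    rw [sumSq_perm hp, sumSq_cons] at hV
    nlinarith
  · push Not at hex
    have h3 := signExcess_walk hδ (by linarith) hq0 (hq.trans ?_)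
      (by positivity : (0 : ℝ) ≤ 4 / 3 / 2 ^ (bs.length + 1)) hW0 hW
      (R := R) (fun r hr => ⟨(hR r hr).1, hex r hr⟩) hfinish (s := 0) (by simpa using hδ)
    · refine h3.trans (le_trans ?_ h2)
      simp only [mul_zero, cos_zero, mul_one]
      have h4 : √2 ≤ 1.4143 := by rw [sqrt_le_left (by norm_num)]; norm_num
      have h5 : 0.3084 * t ≤ 0.3084 / (2 - b) ^ 2 * sumSq R := by
        rw [div_mul_eq_mul_div, le_div_iff₀ (by positivity)]
        linarith
      gcongr
    · have h4 := one_sub_sq_div_two_le_cos (x := π / 6 * (2 * (2 - b)))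
      refine le_trans ?_ h4
      have h5 : (π / 6) ^ 2 / 2 ≤ 0.1371 := by nlinarith [pi_lt_d4, pi_pos]
      have := mul_le_mul_of_nonneg_right h5 (sq_nonneg (2 * (2 - b)))
      linarith

theorem exp_neg_le {s t B : ℝ} (hs : 0 ≤ s) (hst : s ≤ t)
    (hB : 1 ≤ B * (1 + s / 64 + (s / 64) ^ 2 / 2) ^ 64) : exp (-t) ≤ B := by
  refine (exp_le_exp.2 (neg_le_neg hst)).trans ?_
  have h1 : 0 < 1 + s / 64 + (s / 64) ^ 2 / 2 := by positivity
  have h2 : (1 + s / 64 + (s / 64) ^ 2 / 2) ^ 64 ≤ exp s := by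
    refine (pow_le_pow_left₀ h1.le (quadratic_le_exp_of_nonneg (by positivity)) 64).trans_eq ?_
    rw [← exp_nat_mul]
    congr 1
    push_cast
    ring
  have hB0 : 0 < B := pos_of_mul_pos_left (one_pos.trans_le hB) (by positivity)
  rw [exp_neg, inv_le_iff_one_le_mul₀ (exp_pos _)]
  exact hB.trans (mul_le_mul_of_nonneg_left h2 hB0.le)

theorem signExcess_cons_le {R : List ℝ} (hR : IsSmall R) {b s : ℝ} (hb : 0 ≤ b)
    (hbs : |s| + b ≤ 3) :
    signExcess (b :: R) s ≤
      4 / 3 * exp (-(0.137 * (sumSq R + b ^ 2))) + 1 / 3 * exp (-(1.233 * sumSq R)) := by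
  have hp : |s + b| ≤ 3 := (abs_add_le s b).trans (by rwa [abs_of_nonneg hb])
  have hm : |s - b| ≤ 3 := (abs_sub s b).trans (by rwa [abs_of_nonneg hb])
  have h1 := signExcess_le_cosBound hR hp
  have h2 := signExcess_le_cosBound hR hm
  have h3 := cosBound_cons b R s
  have hb3 : b ≤ 3 := by linarith [abs_nonneg s]
  have hc : 0 ≤ cos (π / 6 * b) := by
    apply cos_nonneg_of_neg_pi_div_two_le_of_le <;> nlinarith [pi_pos]
  have hc2 : cos (π / 6 * b) ≤ exp (-(0.137 * b ^ 2)) :=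
    cos_mul_le_exp (by positivity) pi_div_six_sq hb (by nlinarith [pi_pos])
  have hC := cosProd_nonneg hR (θ := π / 6) (by positivity) (by linarith [pi_pos])
  have hC2 := cosProd_le_exp hR (θ := π / 6) (by positivity) (by linarith [pi_pos]) pi_div_six_sq
  have hD := cosProd_nonneg hR (θ := π / 2) (by positivity) le_rfl
  have hD2 := cosProd_le_exp hR (θ := π / 2) (by positivity) le_rfl pi_div_two_sq
  have h4 : cosProd (b :: R) (π / 6) * cos (π / 6 * s) ≤
      exp (-(0.137 * (sumSq R + b ^ 2))) := by
    rw [cosProd_cons, mul_add, neg_add, exp_add, mul_comm (exp _)]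
    calc _ ≤ cos (π / 6 * b) * cosProd R (π / 6) :=
          mul_le_of_le_one_right (mul_nonneg hc hC) (cos_le_one _)
      _ ≤ _ := mul_le_mul hc2 hC2 hC (exp_pos _).le
  have h5 : -(cosProd (b :: R) (π / 2) * cos (π / 2 * s)) ≤ exp (-(1.233 * sumSq R)) := by
    rw [cosProd_cons]
    have h6 : |cos (π / 2 * b) * cos (π / 2 * s)| ≤ 1 := by
      rw [abs_mul]
      exact mul_le_one₀ (abs_cos_le_one _) (abs_nonneg _) (abs_cos_le_one _)
    have h7 := (abs_le.1 h6).1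
    nlinarith
  simp only [cosBound] at h1 h2 h3
  simp only [signExcess]
  linarith

theorem isSmall_cons {r : ℝ} {R : List ℝ} (h0 : 0 ≤ r) (h1 : r ≤ 1) (hR : IsSmall R) :
    IsSmall (r :: R) := by
  intro x hx
  rcases List.mem_cons.1 hx with rfl | hx
  exacts [⟨h0, h1⟩, hR x hx]

theorem signExcess_no_big {R : List ℝ} (hR : IsSmall R)
    (hv : sumSq R = 20) : signExcess R 0 ≤ 3 / 32 := by
  have h1 := signExcess_le_four_thirds_exp hR 0
  have h2 : exp (-(0.137 * sumSq R)) ≤ 0.066 :=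
    exp_neg_le (s := 2.74) (by norm_num) (by linarith) (by norm_num)
  linarith

theorem signExcess_one_big {R : List ℝ} (hR : IsSmall R) {b : ℝ} (hb : 1 ≤ b) (hb2 : b < 2)
    (hv : b ^ 2 + sumSq R = 20) : signExcess (R ++ [b]) 0 ≤ 3 / 32 := by
  rw [signExcess_perm List.perm_append_comm]
  have h1 := signExcess_cons_le hR (b := b) (s := 0) (by linarith) (by simp; linarith)
  have h2 : exp (-(0.137 * (sumSq R + b ^ 2))) ≤ 0.066 :=
    exp_neg_le (s := 2.74) (by norm_num) (by linarith) (by norm_num)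
  have h3 : exp (-(1.233 * sumSq R)) ≤ 0.001 :=
    exp_neg_le (s := 15) (by norm_num) (by nlinarith) (by norm_num)
  simp only [List.cons_append, List.nil_append]
  linarith

theorem signExcess_two_big {R : List ℝ} (hR : IsSmall R) {b₁ b₂ : ℝ} (h1 : 1 ≤ b₁)
    (h12 : b₁ ≤ b₂) (h2 : b₂ < 2) (hv : b₁ ^ 2 + b₂ ^ 2 + sumSq R = 20) :
    signExcess (R ++ [b₁, b₂]) 0 ≤ 3 / 32 := by
  by_cases hb : b₁ * b₂ ≤ 2.82
  · rw [signExcess_perm List.perm_append_comm]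
    have h3 := signExcess_pair_le (s := 0) (b₁ := b₁) (b₂ := b₂) R (by simp; linarith)
    have h4 := signExcess_le_four_thirds_exp
      (isSmall_cons (r := b₂ - b₁) (by linarith) (by linarith) hR) 0
    have h5 : exp (-(0.137 * sumSq ((b₂ - b₁) :: R))) ≤ 0.1405 :=
      exp_neg_le (s := 0.137 * 14.36) (by norm_num) (by rw [sumSq_cons]; linarith) (by norm_num)
    simp only [List.cons_append, List.nil_append]
    linarith
  · have hb1 : 1.41 < b₁ := by nlinarith
    refine signExcess_le_of_alternate (b := b₁) (bs := [b₂]) (Ls := []) (β := 2 - b₂) (W := 1 / 2)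
      (q := 0.809) (V := 12) (t := 30) (by simpa using h12) h1 (by linarith) (by simp)
      (by nlinarith) (by nlinarith) (by norm_num) (by nlinarith) (by norm_num)
      (fun x => (signExcess_le_chainBound ?_ x).trans (by norm_num [chainBound])) hR
      (by nlinarith) (by nlinarith) ?_ ?_
    · simp; constructor <;> linarith
    · have h3 : exp (-(0.137 * (12 - 1))) ≤ 0.25 :=
        exp_neg_le (by norm_num) le_rfl (by norm_num)
      norm_num at h3 ⊢
      linarith
    · have h4 : exp (-(0.137 * 12)) ≤ 0.2 := exp_neg_le (by norm_num) le_rfl (by norm_num)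
      have h5 : exp (-(0.3084 * 30)) ≤ 0.01 := exp_neg_le (by norm_num) le_rfl (by norm_num)
      norm_num at h4 h5 ⊢
      linarith

theorem signExcess_three_big {R : List ℝ} (hR : IsSmall R) {b₁ b₂ b₃ : ℝ} (h1 : 1 ≤ b₁)
    (h12 : b₁ ≤ b₂) (h23 : b₂ ≤ b₃) (h3 : b₃ < 2)
    (hv : b₁ ^ 2 + b₂ ^ 2 + b₃ ^ 2 + sumSq R = 20) :
    signExcess (R ++ [b₁, b₂, b₃]) 0 ≤ 3 / 32 := by
  by_cases hb : b₁ * b₂ ≤ 2.82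
  · rw [signExcess_perm List.perm_append_comm]
    have h4 := signExcess_pair_le (s := 0) (b₁ := b₁) (b₂ := b₂) (b₃ :: R) (by simp; linarith)
    have h5 := signExcess_cons_le (isSmall_cons (r := b₂ - b₁) (by linarith) (by linarith) hR)
      (b := b₃) (s := 0) (by linarith) (by simp; linarith)
    rw [signExcess_perm (List.Perm.swap b₃ (b₂ - b₁) R)] at h4
    have h6 : exp (-(0.137 * (sumSq ((b₂ - b₁) :: R) + b₃ ^ 2))) ≤ 0.1402 :=
      exp_neg_le (s := 0.137 * 14.36) (by norm_num) (by rw [sumSq_cons]; linarith) (by norm_num)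
    have h7 : exp (-(1.233 * sumSq ((b₂ - b₁) :: R))) ≤ 0.0001 :=
      exp_neg_le (s := 1.233 * 8) (by norm_num) (by rw [sumSq_cons]; nlinarith) (by norm_num)
    simp only [List.cons_append, List.nil_append]
    linarith
  · have hb1 : 1.41 < b₁ := by nlinarith
    refine signExcess_le_of_alternate (b := b₁) (bs := [b₂, b₃]) (Ls := []) (β := 2 - b₂)
      (W := 1 / 2) (q := 0.809) (V := 8) (t := 20) ?_ h1 (by linarith) ?_
      (by nlinarith) (by nlinarith) (by norm_num) (by nlinarith) (by norm_num)
      (fun x => (signExcess_le_chainBound ?_ x).trans (by norm_num [chainBound])) hR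
      (by nlinarith) (by nlinarith) ?_ ?_
    · simp; refine ⟨⟨?_, ?_⟩, ?_⟩ <;> linarith
    · simp; linarith
    · simp; refine ⟨?_, ?_, ?_⟩ <;> linarith
    · have h3 : exp (-(0.137 * (8 - 1))) ≤ 0.4 :=
        exp_neg_le (by norm_num) le_rfl (by norm_num)
      norm_num at h3 ⊢
      linarith
    · have h4 : exp (-(0.137 * 8)) ≤ 0.35 := exp_neg_le (by norm_num) le_rfl (by norm_num)
      have h5 : exp (-(0.3084 * 20)) ≤ 0.01 := exp_neg_le (by norm_num) le_rfl (by norm_num)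
      norm_num at h4 h5 ⊢
      linarith

theorem signExcess_four_big {R : List ℝ} (hR : IsSmall R) {b₁ b₂ b₃ b₄ : ℝ} (h1 : 1 ≤ b₁)
    (h12 : b₁ ≤ b₂) (h23 : b₂ ≤ b₃) (h34 : b₃ ≤ b₄) (h4 : b₄ < 2)
    (hv : b₁ ^ 2 + b₂ ^ 2 + b₃ ^ 2 + b₄ ^ 2 + sumSq R = 20) :
    signExcess (R ++ [b₁, b₂, b₃, b₄]) 0 ≤ 3 / 32 := by
  by_cases hv6 : sumSq R ≤ 6
  · have hb1 : 1.41 < b₁ := by nlinarith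
    have hb12 : 3.41 < b₁ + b₂ := by nlinarith
    refine signExcess_le_of_alternate (b := b₁) (bs := [b₂, b₃, b₄]) (Ls := []) (β := 2 - b₂)
      (W := 1 / 4) (q := 0.809) (V := 4) (t := 11.4) ?_ h1 (by linarith) ?_
      (by linarith) (by linarith) (by norm_num) (by nlinarith) (by norm_num)
      (fun x => (signExcess_le_chainBound ?_ x).trans (by norm_num [chainBound])) hR
      (by nlinarith) (by nlinarith) ?_ ?_
    · simp; refine ⟨⟨?_, ?_, ?_⟩, ⟨?_, ?_⟩, ?_⟩ <;> linarith
    · simp; constructor <;> linarith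
    · simp; refine ⟨?_, ?_, ?_, ?_⟩ <;> linarith
    · have h3 : exp (-(0.137 * (4 - 1))) ≤ 0.7 := exp_neg_le (by norm_num) le_rfl (by norm_num)
      norm_num at h3 ⊢
      linarith
    · have h4 : exp (-(0.137 * 4)) ≤ 0.6 := exp_neg_le (by norm_num) le_rfl (by norm_num)
      have h5 : exp (-(0.3084 * 11.4)) ≤ 0.05 := exp_neg_le (by norm_num) le_rfl (by norm_num)
      norm_num at h4 h5 ⊢
      linarith
  rw [not_le] at hv6
  by_cases hA : 3 * (2 - b₂) + (2 - b₃) ≤ 2 ∧ (2 - b₂) + (2 - b₃) ≤ 1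
  · have hp : (R ++ [b₁, b₂, b₃, b₄]).Perm (R ++ ([b₂, b₃, b₄] ++ [b₁])) :=
      (List.perm_append_comm (l₁ := [b₁])).append_left R
    rw [signExcess_perm hp]
    have hpair : [b₂, b₃, b₄].Pairwise (· ≤ ·) := by
      simp; refine ⟨⟨?_, ?_⟩, ?_⟩ <;> linarith
    have hβ : ∀ x ∈ [b₃, b₄], 2 - x ≤ 2 - b₃ := by simp; linarith
    have hbig : ∀ x ∈ [b₂, b₃, b₄] ++ [b₁], 1 ≤ x := by
      simp; refine ⟨?_, ?_, ?_, ?_⟩ <;> linarith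
    have hW : ∀ x, signExcess ([b₂, b₃, b₄] ++ [b₁]) x ≤ 1 / 4 := fun x =>
      (signExcess_le_chainBound hbig x).trans (by norm_num [chainBound])
    have h3 : exp (-(0.137 * (6 - 1))) ≤ 0.52 := exp_neg_le (by norm_num) le_rfl (by norm_num)
    by_cases hb2 : 1.5 ≤ b₂
    · refine signExcess_le_of_alternate (q := 0.8629) (V := 6) (t := 20) hpair (h1.trans h12)
        (by linarith) hβ hA.2 hA.1 (by norm_num) (by nlinarith) (by norm_num) hW hR
        (by nlinarith) (by nlinarith) ?_ ?_
      · norm_num at h3 ⊢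
        linarith
      · have h4 : exp (-(0.137 * 6)) ≤ 0.45 := exp_neg_le (by norm_num) le_rfl (by norm_num)
        have h5 : exp (-(0.3084 * 20)) ≤ 0.01 := exp_neg_le (by norm_num) le_rfl (by norm_num)
        norm_num at h4 h5 ⊢
        linarith
    · rw [not_le] at hb2
      have hv7 : 7.5 ≤ sumSq R := by nlinarith
      refine signExcess_le_of_alternate (q := 0.756) (V := 7.5) (t := 15) hpair (h1.trans h12)
        (by linarith) hβ hA.2 hA.1 (by norm_num) (by nlinarith) (by norm_num) hW hR
        hv7 (by nlinarith) ?_ ?_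
      · have h3 : exp (-(0.137 * (7.5 - 1))) ≤ 0.52 :=
          exp_neg_le (by norm_num) le_rfl (by norm_num)
        norm_num at h3 ⊢
        linarith
      · have h4 : exp (-(0.137 * 7.5)) ≤ 0.37 := exp_neg_le (by norm_num) le_rfl (by norm_num)
        have h5 : exp (-(0.3084 * 15)) ≤ 0.02 := exp_neg_le (by norm_num) le_rfl (by norm_num)
        norm_num at h4 h5 ⊢
        linarith
  rw [signExcess_perm List.perm_append_comm]
  simp only [List.cons_append, List.nil_append]
  by_cases hB : (2 - b₃) + (2 - b₄) ≤ 2 - b₁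
  · have hp : (b₁ :: b₂ :: b₃ :: b₄ :: R).Perm (b₁ :: b₃ :: b₄ :: b₂ :: R) :=
      ((List.perm_append_comm (l₁ := [b₂]) (l₂ := [b₃, b₄])).append_right R).cons b₁
    rw [signExcess_perm hp, signExcess_cons_zero]
    have h5 := signExcess_cons_le_half (u := b₁) (b := b₃) (b₄ :: b₂ :: R) (by linarith)
    have h6 := signExcess_cons_le_half (u := b₃ - b₁) (b := b₄) (b₂ :: R) (by linarith)
    have h7 := signExcess_cons_le_half (u := b₄ - (b₃ - b₁)) (b := b₂) R (by linarith)
    have h8 := signExcess_le_four_thirds_exp hR (b₂ - (b₄ - (b₃ - b₁)))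
    have h9 : exp (-(0.137 * sumSq R)) ≤ 0.5 :=
      exp_neg_le (s := 0.137 * 6) (by norm_num) (by linarith) (by norm_num)
    linarith
  · rw [not_le] at hB
    have hb2 : b₂ ≤ 1.5 := by
      by_contra hb2
      exact hA ⟨by linarith, by linarith⟩
    have hd : |b₂ - b₁| = b₂ - b₁ := abs_of_nonneg (by linarith)
    have h5 := signExcess_pair_le (s := 0) (b₁ := b₁) (b₂ := b₂) (b₃ :: b₄ :: R)
      (by simp; linarith)
    rw [signExcess_cons_zero (b₂ - b₁)] at h5
    have h6 := signExcess_pair_le (s := b₂ - b₁) (b₁ := b₃) (b₂ := b₄) R (by rw [hd]; linarith)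
    have h7 := signExcess_le_four_thirds_exp
      (isSmall_cons (r := b₄ - b₃) (by linarith) (by linarith) hR) (b₂ - b₁)
    have h8 : exp (-(0.137 * sumSq ((b₄ - b₃) :: R))) ≤ 0.28 :=
      exp_neg_le (s := 0.137 * 9.375) (by norm_num) (by rw [sumSq_cons]; nlinarith) (by norm_num)
    linarith

set_option maxHeartbeats 400000 in
theorem signExcess_five_big {R : List ℝ} (hR : IsSmall R) {b₁ b₂ b₃ b₄ b₅ : ℝ} (h1 : 1 ≤ b₁)
    (h12 : b₁ ≤ b₂) (h23 : b₂ ≤ b₃) (h34 : b₃ ≤ b₄) (h45 : b₄ ≤ b₅) (h5 : b₅ < 2)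
    (hv : b₁ ^ 2 + b₂ ^ 2 + b₃ ^ 2 + b₄ ^ 2 + b₅ ^ 2 + sumSq R = 20) :
    signExcess (R ++ [b₁, b₂, b₃, b₄, b₅]) 0 ≤ 3 / 32 := by
  have hsq : ∀ {x y : ℝ}, 1 ≤ x → x ≤ y → x ^ 2 ≤ y ^ 2 := fun hx hxy =>
    pow_le_pow_left₀ (by linarith) hxy 2
  have hq5 := hsq (by linarith) h5.le
  have hq4 := hsq (by linarith) h45
  have hq3 := hsq (by linarith) h34
  have hq2 := hsq (by linarith) h23
  have hq1 := hsq h1 h12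
  by_cases hb1 : 1.5 ≤ b₁
  · have ht : (2 - b₁) ^ 2 * 7 ≤ sumSq R := by
      nlinarith only [hv, hq5, hq4, hq3, hq2,
        mul_nonneg (sub_nonneg.2 hb1) (by linarith : 0 ≤ 2 - b₁)]
    refine signExcess_le_of_alternate (b := b₁) (bs := [b₂, b₃, b₄, b₅]) (Ls := [])
      (β := 2 - b₂) (W := 1 / 4) (q := 0.8629) (V := 0) (t := 7) ?_ h1 (by linarith) ?_
      (by linarith) (by linarith) (by norm_num) (by nlinarith) (by norm_num)
      (fun x => (signExcess_le_chainBound ?_ x).trans (by norm_num [chainBound])) hR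
      (sumSq_nonneg R) ht ?_ ?_
    · simp; refine ⟨⟨?_, ?_, ?_, ?_⟩, ⟨?_, ?_, ?_⟩, ⟨?_, ?_⟩, ?_⟩ <;> linarith
    · simp; refine ⟨?_, ?_, ?_⟩ <;> linarith
    · simp; refine ⟨?_, ?_, ?_, ?_, ?_⟩ <;> linarith
    · have h3 : exp (-(-0.137)) ≤ 2 := by
        have := exp_one_lt_d9
        have h4 : exp (1 / 2) ^ 2 = exp 1 := by rw [← exp_nat_mul]; norm_num
        have h5 : exp (1 / 2) ≤ 2 := by nlinarith [exp_pos (1 / 2)]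
        exact (exp_le_exp.2 (by norm_num)).trans h5
      norm_num at h3 ⊢
      linarith
    · have h5 : exp (-(0.3084 * 7)) ≤ 0.12 := exp_neg_le (by norm_num) le_rfl (by norm_num)
      norm_num at h5 ⊢
      linarith
  rw [not_le] at hb1
  by_cases hA : 3 * (2 - b₂) + (2 - b₃) ≤ 2 ∧ (2 - b₂) + (2 - b₃) ≤ 1
  · have hp : (R ++ [b₁, b₂, b₃, b₄, b₅]).Perm (R ++ ([b₂, b₃, b₄, b₅] ++ [b₁])) :=
      (List.perm_append_comm (l₁ := [b₁])).append_left R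
    rw [signExcess_perm hp]
    have hpair : [b₂, b₃, b₄, b₅].Pairwise (· ≤ ·) := by
      simp; refine ⟨⟨?_, ?_, ?_⟩, ⟨?_, ?_⟩, ?_⟩ <;> linarith
    have hβ : ∀ x ∈ [b₃, b₄, b₅], 2 - x ≤ 2 - b₃ := by simp; constructor <;> linarith
    have hbig : ∀ x ∈ [b₂, b₃, b₄, b₅] ++ [b₁], 1 ≤ x := by
      simp; refine ⟨?_, ?_, ?_, ?_, ?_⟩ <;> linarith
    have hW : ∀ x, signExcess ([b₂, b₃, b₄, b₅] ++ [b₁]) x ≤ 1 / 4 := fun x =>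
      (signExcess_le_chainBound hbig x).trans (by norm_num [chainBound])
    have hv1 : 1.75 ≤ sumSq R := by linarith [hsq h1 hb1.le]
    have hv2 : 2 * ((2 - b₂) * (2 + b₂)) ≤ sumSq R := by linarith
    by_cases hb2 : 1.5 ≤ b₂
    · have hmul := mul_nonneg (sub_nonneg.2 hb2) (by linarith : 0 ≤ 2 - b₂)
      have hmul' := hsq (by norm_num) hb2
      refine signExcess_le_of_alternate (q := 0.8629) (V := 1.75) (t := 14) hpair (h1.trans h12)
        (by linarith) hβ hA.2 hA.1 (by norm_num) (by linarith) (by norm_num) hW hR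
        hv1 (by linarith) ?_ ?_
      · have h3 : exp (-(0.137 * (1.75 - 1))) ≤ 0.91 :=
          exp_neg_le (by norm_num) le_rfl (by norm_num)
        norm_num at h3 ⊢
        linarith
      · have h4 : exp (-(0.137 * 1.75)) ≤ 0.79 := exp_neg_le (by norm_num) le_rfl (by norm_num)
        have h5 : exp (-(0.3084 * 14)) ≤ 0.02 := exp_neg_le (by norm_num) le_rfl (by norm_num)
        norm_num at h4 h5 ⊢
        linarith
    · rw [not_le] at hb2
      have hv7 : 3.5 ≤ sumSq R := by linarith [hsq (by linarith) hb2.le]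
      have hb2' : 4 / 3 ≤ b₂ := by linarith
      have hmul := mul_nonneg (sub_nonneg.2 hb2') (by linarith : 0 ≤ 2 - b₂)
      have hmul' := hsq (by norm_num) hb2'
      refine signExcess_le_of_alternate (q := 0.756) (V := 3.5) (t := 10) hpair (h1.trans h12)
        (by linarith) hβ hA.2 hA.1 (by norm_num) (by linarith) (by norm_num) hW hR
        hv7 (by linarith) ?_ ?_
      · have h3 : exp (-(0.137 * (3.5 - 1))) ≤ 0.8 :=
          exp_neg_le (by norm_num) le_rfl (by norm_num)
        norm_num at h3 ⊢
        linarith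
      · have h4 : exp (-(0.137 * 3.5)) ≤ 0.63 := exp_neg_le (by norm_num) le_rfl (by norm_num)
        have h5 : exp (-(0.3084 * 10)) ≤ 0.05 := exp_neg_le (by norm_num) le_rfl (by norm_num)
        norm_num at h4 h5 ⊢
        linarith
  rw [signExcess_perm List.perm_append_comm]
  simp only [List.cons_append, List.nil_append]
  have hb2 : b₂ ≤ 1.5 := by
    by_contra hb2
    exact hA ⟨by linarith, by linarith⟩
  by_cases hB : (2 - b₄) + (2 - b₅) ≤ 2 - b₁
  · have hv4 : 4.44 ≤ sumSq R := by
      by_cases hC : 3 * (2 - b₂) + (2 - b₃) ≤ 2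
      · have hD : 1 < (2 - b₂) + (2 - b₃) := by
          by_contra hD
          exact hA ⟨hC, not_lt.1 hD⟩
        nlinarith
      · nlinarith
    have hp : (b₁ :: b₂ :: b₃ :: b₄ :: b₅ :: R).Perm (b₁ :: b₄ :: b₅ :: b₂ :: b₃ :: R) :=
      ((List.perm_append_comm (l₁ := [b₂, b₃]) (l₂ := [b₄, b₅])).append_right R).cons b₁
    rw [signExcess_perm hp, signExcess_cons_zero]
    have h6 := signExcess_cons_le_half (u := b₁) (b := b₄) (b₅ :: b₂ :: b₃ :: R) (by linarith)
    have h7 := signExcess_cons_le_half (u := b₄ - b₁) (b := b₅) (b₂ :: b₃ :: R) (by linarith)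
    have h8 := signExcess_cons_le_half (u := b₅ - (b₄ - b₁)) (b := b₂) (b₃ :: R) (by linarith)
    have h9 := signExcess_append_le (l := [b₃]) (signExcess_le_four_thirds_exp hR)
      (b₂ - (b₅ - (b₄ - b₁)))
    have h10 : exp (-(0.137 * sumSq R)) ≤ 0.55 :=
      exp_neg_le (s := 0.137 * 4.44) (by norm_num) (by linarith) (by norm_num)
    simp only [List.cons_append, List.nil_append] at h9
    linarith
  · rw [not_le] at hB
    have hd : |b₂ - b₁| = b₂ - b₁ := abs_of_nonneg (by linarith)
    have h6 := signExcess_pair_le (s := 0) (b₁ := b₁) (b₂ := b₂) (b₃ :: b₄ :: b₅ :: R)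
      (by simp; linarith)
    rw [signExcess_cons_zero (b₂ - b₁)] at h6
    have h7 := signExcess_pair_le (s := b₂ - b₁) (b₁ := b₃) (b₂ := b₄) (b₅ :: R)
      (by rw [hd]; linarith)
    rw [signExcess_perm (List.Perm.swap b₅ (b₄ - b₃) R)] at h7
    have h8 := signExcess_cons_le (isSmall_cons (r := b₄ - b₃) (by linarith) (by linarith) hR)
      (b := b₅) (s := b₂ - b₁) (by linarith) (by rw [hd]; linarith)
    have hb4 : b₄ ≤ 1.75 := by linarith
    have hv9 : 9.375 ≤ sumSq R + b₅ ^ 2 := by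
      have hb2' := hsq (by linarith) hb2
      have hb4' := hsq (by linarith) hb4
      linarith
    have hd' := sq_nonneg (b₄ - b₃)
    have h9 : exp (-(0.137 * (sumSq ((b₄ - b₃) :: R) + b₅ ^ 2))) ≤ 0.279 :=
      exp_neg_le (s := 0.137 * 9.375) (by norm_num) (by rw [sumSq_cons]; linarith) (by norm_num)
    have h10 : exp (-(1.233 * sumSq ((b₄ - b₃) :: R))) ≤ 0.003 :=
      exp_neg_le (s := 1.233 * 5.375) (by norm_num) (by rw [sumSq_cons]; linarith) (by norm_num)
    linarith

theorem signExcess_append_sorted_le {R bs : List ℝ} (hR : IsSmall R)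
    (hs : bs.Pairwise (· ≤ ·)) (hbs : ∀ b ∈ bs, 1 ≤ b ∧ b < 2)
    (hv : sumSq bs + sumSq R = 20) : signExcess (R ++ bs) 0 ≤ 3 / 32 := by
  match bs, hs, hbs, hv with
  | [], _, _, hv =>
    simpa using signExcess_no_big hR (by simpa using hv)
  | [b₁], _, hbs, hv =>
    simp at hbs hv
    exact signExcess_one_big hR hbs.1 hbs.2 hv
  | [b₁, b₂], hs, hbs, hv =>
    simp at hs hbs hv
    exact signExcess_two_big hR hbs.1.1 hs hbs.2.2 (by linarith)
  | [b₁, b₂, b₃], hs, hbs, hv =>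
    simp at hs hbs hv
    exact signExcess_three_big hR hbs.1.1 hs.1.1 hs.2 hbs.2.2.2 (by linarith)
  | [b₁, b₂, b₃, b₄], hs, hbs, hv =>
    simp at hs hbs hv
    exact signExcess_four_big hR hbs.1.1 hs.1.1 hs.2.1.1 hs.2.2 hbs.2.2.2.2 (by linarith)
  | [b₁, b₂, b₃, b₄, b₅], hs, hbs, hv =>
    simp at hs hbs hv
    exact signExcess_five_big hR hbs.1.1 hs.1.1 hs.2.1.1 hs.2.2.1.1 hs.2.2.2 hbs.2.2.2.2.2
      (by linarith)
  | b₁ :: b₂ :: b₃ :: b₄ :: b₅ :: b₆ :: bs, _, hbs, _ =>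
    have hp : (R ++ (b₁ :: b₂ :: b₃ :: b₄ :: b₅ :: b₆ :: bs)).Perm
        ((R ++ bs) ++ [b₁, b₂, b₃, b₄, b₅, b₆]) := by
      rw [List.append_assoc]
      exact (List.perm_append_comm (l₁ := [b₁, b₂, b₃, b₄, b₅, b₆])).append_left R
    rw [signExcess_perm hp]
    refine signExcess_append_le (fun x => (signExcess_le_chainBound ?_ x).trans ?_) 0
    · exact fun b hb => (hbs b (List.mem_append_left bs hb)).1
    · norm_num [chainBound]

theorem signExcess_zero_le {l : List ℝ} (hl : ∀ x ∈ l, 0 ≤ x) (hv : sumSq l = 20) :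
    signExcess l 0 ≤ 3 / 32 := by
  by_cases hex : ∃ x ∈ l, 2 ≤ x
  · obtain ⟨x, hx, hx2⟩ := hex
    rw [signExcess_perm (List.perm_cons_erase hx), signExcess_cons_zero]
    exact (signExcess_nonpos _ (hx2.trans (le_abs_self x))).trans (by norm_num)
  · push Not at hex
    set bs := (l.filter fun x => 1 ≤ x).insertionSort (· ≤ ·)
    set R := l.filter fun x => !decide (1 ≤ x)
    have hbs : bs.Perm (l.filter fun x => 1 ≤ x) := List.perm_insertionSort _ _
    have hp : l.Perm (R ++ bs) :=
      (List.filter_append_perm _ l).symm.trans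
        (List.perm_append_comm.trans (hbs.symm.append_left R))
    rw [signExcess_perm hp]
    refine signExcess_append_sorted_le ?_ (List.pairwise_insertionSort _ _) ?_ ?_
    · intro x hx
      obtain ⟨h1, h2⟩ := List.mem_filter.1 hx
      exact ⟨hl x h1, by simpa using (le_of_lt (by simpa using h2))⟩
    · intro x hx
      obtain ⟨h1, h2⟩ := List.mem_filter.1 (hbs.mem_iff.1 hx)
      exact ⟨by simpa using h2, hex x h1⟩
    · rw [← hv, sumSq_perm hp, sumSq_append, add_comm]

theorem abs_rademacher_ge_inv_sqrt5 (n : ℕ) (hn : 0 < n) (a : Fin n → ℝ)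
    (hnorm : ∑ i, (a i) ^ 2 = 1) :
    radProb a (fun x => |x| ≥ 1 / Real.sqrt 5) ≥ 29 / 64 := by
  set l := List.ofFn fun i => √20 * a i with hl
  have h20 : √20 ^ 2 = 20 := sq_sqrt (by norm_num)
  have hle : signExcess l 0 ≤ 3 / 32 := by
    rw [← signExcess_map_abs]
    refine signExcess_zero_le (fun x hx => ?_) ?_
    · obtain ⟨y, -, rfl⟩ := List.mem_map.1 hx
      exact abs_nonneg y
    · simp only [sumSq, hl, List.map_ofFn, List.sum_ofFn, Function.comp_apply, sq_abs, mul_pow, h20]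
      rw [← Finset.mul_sum, hnorm, mul_one]
  have hiff : ∀ x : ℝ, |√20 * x| < 2 ↔ ¬ |x| ≥ 1 / √5 := by
    intro x
    have h5 : √20 = 2 * √5 := by
      rw [show (20 : ℝ) = 2 ^ 2 * 5 by norm_num, sqrt_mul (by norm_num), sqrt_sq (by norm_num)]
    have h5pos : 0 < √5 := by positivity
    rw [ge_iff_le, not_le, lt_div_iff₀ h5pos, h5, abs_mul, abs_of_pos (by positivity : 0 < 2 * √5)]
    constructor <;> intro h <;> linarith
  have hsum : ∀ ε : Fin n → Bool, 0 + ∑ i, √20 * a i * (if ε i then (1 : ℝ) else -1) =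
      √20 * ∑ i, a i * (if ε i then (1 : ℝ) else -1) := by
    intro ε
    rw [zero_add, Finset.mul_sum]
    simp only [mul_assoc]
  rw [hl, signExcess_ofFn] at hle
  simp only [hsum, hiff] at hle
  rw [radProb, Nat.card_eq_fintype_card, Fintype.card_fin]
  set P : (Fin n → Bool) → Prop :=
    fun ε => |∑ i, a i * (if ε i then (1 : ℝ) else -1)| ≥ 1 / √5
  have hcard : (Fintype.card {ε | P ε} : ℝ) = ∑ ε, if P ε then (1 : ℝ) else 0 := by
    rw [Finset.sum_boole]
    exact congrArg _ (Fintype.card_subtype P)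
  have hpow : ∑ _ε : Fin n → Bool, (1 : ℝ) = 2 ^ n := by simp
  have hsplit : (∑ ε, if ¬ P ε then (1 : ℝ) else -1) =
      ∑ _ε : Fin n → Bool, (1 : ℝ) - 2 * ∑ ε, if P ε then (1 : ℝ) else 0 := by
    rw [Finset.mul_sum, ← Finset.sum_sub_distrib]
    refine Finset.sum_congr rfl fun ε _ => ?_
    by_cases h : P ε <;> simp [h]
    norm_num
  have hpos : (0 : ℝ) < 2 ^ n := by positivity
  change _ / _ ≤ _ at hle
  rw [ge_iff_le, le_div_iff₀ hpos]
  rw [div_le_iff₀ hpos] at hle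
  have hle' : (∑ ε, if ¬ P ε then (1 : ℝ) else -1) ≤ 3 / 32 * 2 ^ n := by
    convert hle
  have : (Fintype.card {ε | P ε} : ℝ) ≥ 29 / 64 * 2 ^ n := by linarith
  convert this
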